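/- arXiv:2604.27959 — 3 statements merged into one kernel-verified Lean document; each statement's English description precedes it below -/
import Mathlib

section
/- Let α, β, β', γ, ε, δ be measurable spaces, let k be a Markov kernel from α to β × γ, let κ be a Markov kernel from β to β' (the interface kernel), and let l be a Markov kernel from β' × ε to δ. Then the assignment sending (a, e) ∈ α × ε to the measure on γ × δ given by E ↦ ∫_{β×γ} ∫_{β'} ∫_{δ} 1_E(c, d) l(dd | (b', e)) κ(db' | b) k(d(b,c) | a) is a Markov kernel from α × ε to γ × δ; that is, each such measure is a probability measure and the assignment is measurable in (a, e). -/
open MeasureTheory ProbabilityTheory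

/-- Binary colored kernel slotwise composition (CKSC): given a Markov kernel
`k : α → β × γ`, an interface Markov kernel `κ : β → β'` and a Markov kernel
`l : β' × ε → δ`, the assignment sending `(a, e)` to the measure
`E ↦ ∫_{β×γ} ∫_{β'} ∫_δ 1_E(c, d) l(dd ∣ (b', e)) κ(db' ∣ b) k(d(b,c) ∣ a)`
is a Markov kernel from `α × ε` to `γ × δ`. -/
theorem cksc_is_markov_kernel {α β β' γ ε δ : Type*}
    [MeasurableSpace α] [MeasurableSpace β] [MeasurableSpace β'] [MeasurableSpace γ]
    [MeasurableSpace ε] [MeasurableSpace δ]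
    (k : Kernel α (β × γ)) (κ : Kernel β β') (l : Kernel (β' × ε) δ)
    [IsMarkovKernel k] [IsMarkovKernel κ] [IsMarkovKernel l] :
    ∃ K : Kernel (α × ε) (γ × δ), IsMarkovKernel K ∧
      ∀ (a : α) (e : ε) (E : Set (γ × δ)), MeasurableSet E →
        K (a, e) E =
          ∫⁻ bc : β × γ, ∫⁻ b' : β', ∫⁻ d : δ,
            E.indicator (fun _ => (1 : ENNReal)) (bc.2, d)
              ∂(l (b', e)) ∂(κ bc.1) ∂(k a) := by
  have hk : Measurable (fun p : (α × ε) × (β × γ) => p.2.1) := by fun_prop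
  have hl : Measurable (fun p : (α × ε) × ((β × γ) × β') => (p.2.2, p.1.2)) := by fun_prop
  have hm : Measurable (fun q : ((β × γ) × β') × δ => (q.1.1.2, q.2)) := by fun_prop
  refine ⟨(((k.comap Prod.fst measurable_fst) ⊗ₖ (κ.comap _ hk)) ⊗ₖ (l.comap _ hl)).map
    (fun q : ((β × γ) × β') × δ => (q.1.1.2, q.2)), Kernel.IsMarkovKernel.map _ hm, ?_⟩
  intro a e E hE
  have hf : Measurable (E.indicator (fun _ => (1 : ENNReal))) := measurable_const.indicator hE
  have hg : Measurable (fun q : ((β × γ) × β') × δ =>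
      E.indicator (fun _ => (1 : ENNReal)) (q.1.1.2, q.2)) := hf.comp hm
  rw [← lintegral_indicator_one hE]
  change ∫⁻ x, E.indicator (fun _ => (1 : ENNReal)) x ∂_ = _
  rw [Kernel.lintegral_map _ hm _ hf, Kernel.lintegral_compProd _ _ _ hg,
    Kernel.lintegral_compProd]
  · simp only [Kernel.comap_apply]
  · exact Measurable.lintegral_kernel_prod_right'
      (κ := (l.comap _ hl).comap (fun x => ((a, e), x)) measurable_prodMk_left) hg
end

section
/- Let α, β, β', γ, ε, δ be measurable spaces, let k be a Markov kernel from α to β × γ, let κ be a Markov kernel from β to β', and let l be a Markov kernel from β' × ε to δ. Define k' : α → Measure (β' × γ) by k'(a) = (k a).bind (fun (b,c) ↦ (κ b).map (fun b' ↦ (b', c))) (the kernel obtained by attaching the interface kernel κ to the connected output wire of k), which is a Markov kernel from α to β' × γ. Then for every (a, e) ∈ α × ε and every measurable set E ⊆ γ × δ, the CKSC composite measure ∫_{β×γ} ∫_{β'} ∫_{δ} 1_E(c, d) l(dd | (b', e)) κ(db' | b) k(d(b,c) | a) equals the binary KSC composite of l with k', namely ∫_{β'×γ} ∫_{δ} 1_E(c,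 d) l(dd | (b', e)) k'(d(b',c) | a). -/
open MeasureTheory ProbabilityTheory

/-- The kernel obtained from `k : α → β × γ` by attaching the interface kernel
`κ : β → β'` to the connected output wire `β`. -/
noncomputable def attachInterface {α β β' γ : Type*}
    [MeasurableSpace α] [MeasurableSpace β] [MeasurableSpace β'] [MeasurableSpace γ]
    (k : ProbabilityTheory.Kernel α (β × γ)) (κ : ProbabilityTheory.Kernel β β')
    (a : α) : Measure (β' × γ) :=
  (k a).bind (fun bc => (κ bc.1).map (fun b' => (b', bc.2)))

/-- The CKSC composite of `l` with `k` through the interface kernel `κ` equals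
the binary KSC composite of `l` with the kernel `k'` obtained by attaching `κ`
to the connected output wire of `k`; moreover `k'` is a Markov kernel. -/
theorem cksc_eq_ksc_attachInterface {α β β' γ ε δ : Type*}
    [MeasurableSpace α] [MeasurableSpace β] [MeasurableSpace β'] [MeasurableSpace γ]
    [MeasurableSpace ε] [MeasurableSpace δ]
    (k : Kernel α (β × γ)) (κ : Kernel β β') (l : Kernel (β' × ε) δ)
    [IsMarkovKernel k] [IsMarkovKernel κ] [IsMarkovKernel l] :
    (∀ a : α, IsProbabilityMeasure (attachInterface k κ a)) ∧
    ∀ (a : α) (e : ε) (E : Set (γ × δ)), MeasurableSet E →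
      (∫⁻ bc : β × γ, ∫⁻ b' : β', ∫⁻ d : δ,
          E.indicator (fun _ => (1 : ENNReal)) (bc.2, d)
            ∂(l (b', e)) ∂(κ bc.1) ∂(k a)) =
      ∫⁻ bc' : β' × γ, ∫⁻ d : δ,
          E.indicator (fun _ => (1 : ENNReal)) (bc'.2, d)
            ∂(l (bc'.1, e)) ∂(attachInterface k κ a) := by
  have hm : Measurable (fun bc : β × γ => (κ bc.1).map (fun b' => (b', bc.2))) := by
    have h : (fun bc : β × γ => (κ bc.1).map (fun b' => (b', bc.2))) =
        fun bc => ((κ.comap Prod.fst measurable_fst) ×ₖ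
          (Kernel.deterministic (Prod.snd : β × γ → γ) measurable_snd)) bc := by
      funext bc
      rw [Kernel.prod_apply, Kernel.comap_apply, Kernel.deterministic_apply, Measure.prod_dirac]
    rw [h]
    exact Kernel.measurable _
  have hp : ∀ c : γ, Measurable (fun b' : β' => (b', c)) := fun c => measurable_prodMk_right
  refine ⟨fun a => ⟨?_⟩, fun a e E hE => ?_⟩
  · rw [attachInterface, Measure.bind_apply MeasurableSet.univ hm.aemeasurable]
    have h1 : ∀ bc : β × γ, ((κ bc.1).map (fun b' => (b', bc.2))) Set.univ = 1 := by
      intro bc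
      rw [Measure.map_apply (hp _) MeasurableSet.univ]
      simp
    simp [h1]
  · have hf : Measurable (fun bc' : β' × γ => ∫⁻ d : δ,
        E.indicator (fun _ => (1 : ENNReal)) (bc'.2, d) ∂(l (bc'.1, e))) := by
      have hg : Measurable (fun p : (β' × γ) × δ =>
          E.indicator (fun _ => (1 : ENNReal)) (p.1.2, p.2)) :=
        (measurable_const.indicator hE).comp (by fun_prop)
      have hc : Measurable (fun p : β' × γ => (p.1, e)) := by fun_prop
      exact Measurable.lintegral_kernel_prod_right (κ := l.comap _ hc) hg
    rw [attachInterface, Measure.lintegral_bind hm.aemeasurable hf.aemeasurable]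
    refine lintegral_congr fun bc => ?_
    rw [lintegral_map hf (hp _)]
end

section
/- Local reverse rule: let E be a finite-dimensional real normed space, let Ω be a measurable space, and let P : E → Measure Ω be a family of probability measures. Let A, B, S be measurable spaces (standard Borel), let X_A : Ω → A, X_B : Ω → B, X_S : Ω → S be measurable maps, and let J : Ω → ℝ be measurable and integrable under each P(θ). Let λ be a probability measure on A × S, and for each θ let k(θ) be a Markov kernel from A × S to B. Assume: (i) (admissible local context) for every θ and every bounded measurable φ : A × B × S → ℝ, ∫_Ω φ(X_A ω, X_B ω, X_S ω) P(θ)(dω) = ∫_{A×S} ∫_B φ(a, b, s) k(θ)(db | (a,s)) λ(d(a,s)); (ii) (conditional expected future objective) Q : A × B × S → ℝ is measurable and for every θ, Q(X_A, X_B, X_S) is a version of the conditional expectation of J given the σ-algebra generated by (X_A, X_B, X_S) under P(θ); (iii) (admissible local gradient operator) G : A × B × S → (E →L[ℝ] ℝ) is measurable, the function F(θ) = ∫_{A×S} ∫_B Q(a,b,s) k(θ)(db | (a,s)) λ(d(a,s)) is differentiable at θ₀ with fderiv F θ₀ = ∫_{A×S} ∫_B G(a,b,s) k(θ₀)(db |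 (a,s)) λ(d(a,s)), and ω ↦ G(X_A ω, X_B ω, X_S ω) is Bochner integrable under P(θ₀) with the context identity (i) valid for each real component of G. Then the expected objective L(θ) = ∫_Ω J dP(θ) is differentiable at θ₀ with fderiv L θ₀ = ∫_Ω G(X_A ω, X_B ω, X_S ω) P(θ₀)(dω). -/
open MeasureTheory ProbabilityTheory

/-- Local reverse rule: if the trace law of a parameterized stochastic diagram
factors through a local Markov kernel `k θ` at a vertex (admissible local
context), `Q` is a conditional expected future objective for the vertex's
input, output and context variables, and `G` is an admissible local gradient
operator for `Q`, then the expected objective `L θ = ∫ J dP(θ)` is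
differentiable at `θ₀` with derivative the expectation under the trace law of
the local gradient contribution. -/
theorem local_reverse_rule
    {E : Type*} [NormedAddCommGroup E] [NormedSpace ℝ E] [FiniteDimensional ℝ E]
    {Ω : Type*} [MeasurableSpace Ω]
    (P : E → Measure Ω) (hP : ∀ θ, IsProbabilityMeasure (P θ))
    {A B S : Type*} [MeasurableSpace A] [MeasurableSpace B] [MeasurableSpace S]
    [StandardBorelSpace A] [StandardBorelSpace B] [StandardBorelSpace S]
    (XA : Ω → A) (XB : Ω → B) (XS : Ω → S)
    (hXA : Measurable XA) (hXB : Measurable XB) (hXS : Measurable XS)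
    (J : Ω → ℝ) (hJ_meas : Measurable J) (hJ_int : ∀ θ, Integrable J (P θ))
    (lam : Measure (A × S)) [IsProbabilityMeasure lam]
    (k : E → Kernel (A × S) B) (hk : ∀ θ, IsMarkovKernel (k θ))
    -- (i) admissible local context
    (h_context : ∀ (θ : E) (φ : A × B × S → ℝ), Measurable φ →
      (∃ C : ℝ, ∀ x, |φ x| ≤ C) →
      (∫ ω, φ (XA ω, XB ω, XS ω) ∂(P θ)) =
        ∫ as : A × S, ∫ b, φ (as.1, b, as.2) ∂(k θ as) ∂lam)
    -- (ii) conditional expected future objective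
    (Q : A × B × S → ℝ) (hQ_meas : Measurable Q)
    (hQ_condexp : ∀ θ : E,
      (fun ω => Q (XA ω, XB ω, XS ω)) =ᵐ[P θ]
        (P θ)[J | MeasurableSpace.comap (fun ω => (XA ω, XB ω, XS ω)) inferInstance])
    -- (iii) admissible local gradient operator
    (G : A × B × S → (E →L[ℝ] ℝ)) (hG_meas : StronglyMeasurable G)
    (F : E → ℝ)
    (hF_def : ∀ θ, F θ = ∫ as : A × S, ∫ b, Q (as.1, b, as.2) ∂(k θ as) ∂lam)
    (θ₀ : E)
    (hF_diff : DifferentiableAt ℝ F θ₀)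
    (hF_deriv : fderiv ℝ F θ₀ =
      ∫ as : A × S, ∫ b, G (as.1, b, as.2) ∂(k θ₀ as) ∂lam)
    (hG_int : Integrable (fun ω => G (XA ω, XB ω, XS ω)) (P θ₀))
    (hG_context : ∀ v : E,
      (∫ ω, G (XA ω, XB ω, XS ω) v ∂(P θ₀)) =
        ∫ as : A × S, ∫ b, G (as.1, b, as.2) v ∂(k θ₀ as) ∂lam) :
    HasFDerivAt (fun θ => ∫ ω, J ω ∂(P θ))
      (∫ ω, G (XA ω, XB ω, XS ω) ∂(P θ₀)) θ₀ := by
  have hX : Measurable (fun ω => (XA ω, XB ω, XS ω)) := hXA.prodMk (hXB.prodMk hXS)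
  have he : Measurable (fun p : (A × S) × B => (p.1.1, p.2, p.1.2)) := by fun_prop
  have hlaw : ∀ θ, (P θ).map (fun ω => (XA ω, XB ω, XS ω)) =
      (lam ⊗ₘ (k θ)).map (fun p : (A × S) × B => (p.1.1, p.2, p.1.2)) := by
    intro θ
    haveI := hP θ
    haveI := hk θ
    haveI : IsProbabilityMeasure ((P θ).map (fun ω => (XA ω, XB ω, XS ω))) :=
      Measure.isProbabilityMeasure_map hX.aemeasurable
    haveI : IsProbabilityMeasure
        ((lam ⊗ₘ (k θ)).map (fun p : (A × S) × B => (p.1.1, p.2, p.1.2))) :=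
      Measure.isProbabilityMeasure_map he.aemeasurable
    ext s hs
    have hφ : Measurable (s.indicator (fun _ => (1 : ℝ))) := measurable_const.indicator hs
    have hbd : ∀ x, |s.indicator (fun _ => (1 : ℝ)) x| ≤ 1 := by
      intro x
      by_cases hx : x ∈ s <;> simp [hx]
    have h1 := h_context θ _ hφ ⟨1, hbd⟩
    have hint : Integrable (fun p : (A × S) × B =>
        s.indicator (fun _ => (1 : ℝ)) (p.1.1, p.2, p.1.2)) (lam ⊗ₘ (k θ)) :=
      Integrable.of_bound (hφ.comp he).aestronglyMeasurable 1
        (Filter.Eventually.of_forall fun p => hbd _)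
    have h2 := Measure.integral_compProd hint
    rw [← h2, ← integral_map hX.aemeasurable hφ.aestronglyMeasurable,
      ← integral_map (φ := fun p : (A × S) × B => (p.1.1, p.2, p.1.2))
        he.aemeasurable hφ.aestronglyMeasurable,
      integral_indicator_const _ hs, integral_indicator_const _ hs] at h1
    simp only [smul_eq_mul, mul_one] at h1
    exact (measureReal_eq_measureReal_iff).1 h1
  have key : ∀ (θ : E)
      (g : A × B × S → (E →L[ℝ] ℝ)), StronglyMeasurable g →
      Integrable (fun ω => g (XA ω, XB ω, XS ω)) (P θ) →
      (∫ ω, g (XA ω, XB ω, XS ω) ∂(P θ)) =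
        ∫ as : A × S, ∫ b, g (as.1, b, as.2) ∂(k θ as) ∂lam := by
    intro θ g hg hi
    haveI := hP θ
    haveI := hk θ
    have hi' := (integrable_map_measure hg.aestronglyMeasurable hX.aemeasurable).2 hi
    rw [hlaw θ] at hi'
    have hi2 := (integrable_map_measure hg.aestronglyMeasurable he.aemeasurable).1 hi'
    have h2 := Measure.integral_compProd hi2
    rw [← integral_map hX.aemeasurable hg.aestronglyMeasurable, hlaw θ,
      integral_map he.aemeasurable hg.aestronglyMeasurable]
    exact h2
  have keyR : ∀ (θ : E)
      (g : A × B × S → ℝ), StronglyMeasurable g →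
      Integrable (fun ω => g (XA ω, XB ω, XS ω)) (P θ) →
      (∫ ω, g (XA ω, XB ω, XS ω) ∂(P θ)) =
        ∫ as : A × S, ∫ b, g (as.1, b, as.2) ∂(k θ as) ∂lam := by
    intro θ g hg hi
    haveI := hP θ
    haveI := hk θ
    have hi' := (integrable_map_measure hg.aestronglyMeasurable hX.aemeasurable).2 hi
    rw [hlaw θ] at hi'
    have hi2 := (integrable_map_measure hg.aestronglyMeasurable he.aemeasurable).1 hi'
    have h2 := Measure.integral_compProd hi2
    rw [← integral_map hX.aemeasurable hg.aestronglyMeasurable, hlaw θ,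
      integral_map he.aemeasurable hg.aestronglyMeasurable]
    exact h2
  have hL : (fun θ => ∫ ω, J ω ∂(P θ)) = F := by
    funext θ
    haveI := hP θ
    have hQi : Integrable (fun ω => Q (XA ω, XB ω, XS ω)) (P θ) :=
      integrable_condExp.congr (hQ_condexp θ).symm
    rw [hF_def, ← integral_condExp hX.comap_le, ← integral_congr_ae (hQ_condexp θ)]
    exact keyR θ Q hQ_meas.stronglyMeasurable hQi
  rw [hL, key θ₀ G hG_meas hG_int, ← hF_deriv]
  exact hF_diff.hasFDerivAt
end
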